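/- Let n ≥ 1 be an integer, a ∈ [0,1) and 0 ≤ b < n. There are constants C = C(n,a,b) and t0 = t0(n,a,b) such that the following holds. Let Θ₀ : ℝⁿ → ℝ be measurable with |Θ₀(y)| ≤ ⟨y⟩^{−b} (log(2+|y|))^{−a} for all y, and define Θ(x,t) := (4πt)^{−n/2} ∫_{ℝⁿ} e^{−|x−y|²/(4t)} Θ₀(y) dy for t > 0. Then for all t ≥ t0 and x ∈ ℝⁿ: |∇_x Θ(x,t)| ≤ C ⟨t⟩^{−b/2} (log(2+t))^{−a} t^{−1/2} if |x| ≤ √t, and |∇_x Θ(x,t)| ≤ C ⟨x⟩^{−b} (log(2+|x|))^{−a} (|x|/t) if |x| > √t. -/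

import Mathlib

open MeasureTheory

/-- The decay weight `⟨r⟩^{-b} (log (2+r))^{-a}`. -/
noncomputable def heatWgt (a b r : ℝ) : ℝ := Real.sqrt (1 + r ^ 2) ^ (-b) * Real.log (2 + r) ^ (-a)

lemma heatWgt_log_pos {r : ℝ} (hr : 0 ≤ r) : 0 < Real.log (2 + r) := Real.log_pos (by linarith)

lemma heatWgt_pos (a b : ℝ) {r : ℝ} (hr : 0 ≤ r) : 0 < heatWgt a b r := by
  have := heatWgt_log_pos hr
  unfold heatWgt
  positivity

lemma heatWgt_anti {a b : ℝ} (ha : 0 ≤ a) (hb : 0 ≤ b) {r R : ℝ} (hr : 0 ≤ r) (h : r ≤ R) :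
    heatWgt a b R ≤ heatWgt a b r := by
  unfold heatWgt
  have h1 := heatWgt_log_pos hr
  have h2 := heatWgt_log_pos (hr.trans h)
  apply mul_le_mul
  · apply Real.rpow_le_rpow_of_nonpos (by positivity) _ (by linarith)
    apply Real.sqrt_le_sqrt
    nlinarith
  · apply Real.rpow_le_rpow_of_nonpos h1 _ (by linarith)
    apply Real.log_le_log (by linarith) (by linarith)
  · positivity
  · positivity

lemma heatWgt_growth {a b β : ℝ} (ha : 0 ≤ a) (ha1 : a < 1) (hb : 0 ≤ b) (hβ : b < β) :
    ∃ M : ℝ, 0 < M ∧ ∀ r R : ℝ, 0 < r → r ≤ R →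
      heatWgt a b r ≤ M * heatWgt a b R * (R / r) ^ β := by
  set δ := β - b with hδ
  have hδ0 : 0 < δ := by linarith
  have hl2 : 0 < Real.log 2 := Real.log_pos (by norm_num)
  refine ⟨1 + 1 / (δ * Real.log 2), by positivity, fun r R hr h => ?_⟩
  set M := 1 + 1 / (δ * Real.log 2) with hM
  have hR : 0 < R := hr.trans_le h
  set q := R / r with hq
  have hq1 : 1 ≤ q := by rw [hq, le_div_iff₀ hr]; linarith
  have hq0 : 0 < q := by linarith
  have hRq : R = q * r := by rw [hq]; field_simp
  have L1 := heatWgt_log_pos hr.le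
  have L2 := heatWgt_log_pos hR.le
  have hqδ : 1 ≤ q ^ δ := Real.one_le_rpow hq1 hδ0.le
  have hM1 : 1 ≤ M := by rw [hM]; have : 0 < 1 / (δ * Real.log 2) := by positivity
                         linarith
  have hA : Real.sqrt (1 + r ^ 2) ^ (-b) ≤ Real.sqrt (1 + R ^ 2) ^ (-b) * q ^ b := by
    have h1 : Real.sqrt (1 + R ^ 2) ≤ q * Real.sqrt (1 + r ^ 2) := by
      apply Real.sqrt_le_iff.2
      refine ⟨by positivity, ?_⟩
      rw [mul_pow, Real.sq_sqrt (by positivity), hRq]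
      nlinarith
    have h2 := Real.rpow_le_rpow_of_nonpos (by positivity) h1 (by linarith : -b ≤ 0)
    rw [Real.mul_rpow hq0.le (by positivity)] at h2
    calc Real.sqrt (1 + r ^ 2) ^ (-b) = (q ^ (-b) * Real.sqrt (1 + r ^ 2) ^ (-b)) * q ^ b := by
          rw [Real.rpow_neg hq0.le]; field_simp
      _ ≤ _ := by gcongr
  have hB : Real.log (2 + r) ^ (-a) ≤ Real.log (2 + R) ^ (-a) * (M * q ^ δ) := by
    have h0 : Real.log (2 + R) ≤ Real.log (2 + r) + Real.log q := by
      rw [← Real.log_mul (by linarith) (by linarith)]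
      apply Real.log_le_log (by linarith)
      rw [hRq]; nlinarith
    have h1 : Real.log q ≤ q ^ δ / δ := Real.log_le_rpow_div hq0.le hδ0
    have h3 : Real.log 2 ≤ Real.log (2 + r) := Real.log_le_log (by norm_num) (by linarith)
    have h2 : Real.log (2 + R) ≤ (M * q ^ δ) * Real.log (2 + r) := by
      have : q ^ δ / δ ≤ 1 / (δ * Real.log 2) * q ^ δ * Real.log (2 + r) := by
        calc q ^ δ / δ = 1 / (δ * Real.log 2) * q ^ δ * Real.log 2 := by field_simp
          _ ≤ _ := by gcongr
      have : Real.log (2 + r) ≤ q ^ δ * Real.log (2 + r) := by nlinarith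
      rw [hM]
      linarith
    have h4 := Real.rpow_le_rpow_of_nonpos L2 h2 (by linarith : -a ≤ 0)
    have hMq : 1 ≤ M * q ^ δ := by nlinarith
    have hMq0 : 0 < M * q ^ δ := by linarith
    rw [Real.mul_rpow hMq0.le L1.le] at h4
    calc Real.log (2 + r) ^ (-a)
        = ((M * q ^ δ) ^ (-a) * Real.log (2 + r) ^ (-a)) * (M * q ^ δ) ^ a := by
          rw [Real.rpow_neg hMq0.le]; field_simp
      _ ≤ Real.log (2 + R) ^ (-a) * (M * q ^ δ) ^ (1:ℝ) := by
          gcongr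
      _ = _ := by rw [Real.rpow_one]
  unfold heatWgt
  calc _ ≤ (Real.sqrt (1 + R ^ 2) ^ (-b) * q ^ b) * (Real.log (2 + R) ^ (-a) * (M * q ^ δ)) := by
        gcongr
    _ = M * (Real.sqrt (1 + R ^ 2) ^ (-b) * Real.log (2 + R) ^ (-a)) * (q ^ b * q ^ δ) := by ring
    _ = _ := by rw [← Real.rpow_add hq0]; congr 2; rw [hδ]; ring

lemma heat_gauss_integral {n : ℕ} {c : ℝ} (hc : 0 < c) (x : EuclideanSpace ℝ (Fin n)) :
    Integrable (fun y : EuclideanSpace ℝ (Fin n) => Real.exp (-‖x - y‖ ^ 2 / c)) ∧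
    ∫ y : EuclideanSpace ℝ (Fin n), Real.exp (-‖x - y‖ ^ 2 / c) = (Real.pi * c) ^ ((n : ℝ) / 2) := by
  have h := GaussianFourier.integral_rexp_neg_mul_sq_norm (V := EuclideanSpace ℝ (Fin n))
    (b := c⁻¹) (by positivity)
  have h2 : (fun y : EuclideanSpace ℝ (Fin n) => Real.exp (-‖x - y‖ ^ 2 / c)) =
      fun y => (fun v : EuclideanSpace ℝ (Fin n) => Real.exp (-c⁻¹ * ‖v‖ ^ 2)) (x - y) := by
    funext y
    congr 1
    field_simp
  have h3 : ∫ y : EuclideanSpace ℝ (Fin n), Real.exp (-‖x - y‖ ^ 2 / c)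
      = (Real.pi * c) ^ ((n : ℝ) / 2) := by
    rw [h2, integral_sub_left_eq_self (fun v : EuclideanSpace ℝ (Fin n) => Real.exp (-c⁻¹ * ‖v‖ ^ 2)), h]
    simp
  refine ⟨?_, h3⟩
  by_contra hh
  rw [integral_undef hh] at h3
  have : 0 < (Real.pi * c) ^ ((n : ℝ) / 2) := by positivity
  linarith

lemma heat_ball_integrable {n : ℕ} (hn : 1 ≤ n) {β : ℝ} (hβ : β < n) :
    Integrable (fun y : EuclideanSpace ℝ (Fin n) =>
      (Set.Iio (1:ℝ)).indicator (fun s => s ^ (-β)) ‖y‖) := by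
  have : Nonempty (Fin n) := ⟨⟨0, hn⟩⟩
  rw [integrable_fun_norm_addHaar volume (f := (Set.Iio (1:ℝ)).indicator (fun s => s ^ (-β)))]
  have h := (intervalIntegral.integrableOn_Ioo_rpow_iff (s := (n:ℝ) - 1 - β) (t := 1) one_pos).2
    (by linarith)
  have h2 := (integrable_indicator_iff measurableSet_Ioo).2 h
  refine (h2.integrableOn (s := Set.Ioi 0)).congr_fun (fun s (hs : 0 < s) => ?_) measurableSet_Ioi
  by_cases h1 : s < 1
  · simp only [finrank_euclideanSpace_fin, smul_eq_mul]
    rw [Set.indicator_of_mem (show s ∈ Set.Ioo 0 1 from ⟨hs, h1⟩),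
      Set.indicator_of_mem (show s ∈ Set.Iio 1 from h1), ← Real.rpow_natCast, ← Real.rpow_add hs,
      Nat.cast_sub hn]
    congr 1
    push_cast
    ring
  · rw [Set.indicator_of_notMem (fun h => h1 h.2), Set.indicator_of_notMem (show s ∉ Set.Iio 1 from h1)]
    simp

lemma heat_pow_exp (n : ℕ) {s : ℝ} (hs : 1 ≤ s) :
    s ^ n * Real.exp (-s ^ 2 / 64) ≤ 64 ^ n * n.factorial := by
  have h := Real.pow_div_factorial_le_exp (x := s ^ 2 / 64) (by positivity) n
  have h1 : s ^ n ≤ (s ^ 2) ^ n := by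
    apply pow_le_pow_left₀ (by linarith)
    nlinarith
  rw [div_le_iff₀ (by positivity), div_pow, div_le_iff₀ (by positivity)] at h
  have h2 : Real.exp (-s ^ 2 / 64) * Real.exp (s ^ 2 / 64) = 1 := by
    rw [← Real.exp_add]; simp [neg_div]
  calc s ^ n * Real.exp (-s ^ 2 / 64)
      ≤ (Real.exp (s ^ 2 / 64) * n.factorial * 64 ^ n) * Real.exp (-s ^ 2 / 64) := by
        gcongr; linarith
    _ = (Real.exp (-s ^ 2 / 64) * Real.exp (s ^ 2 / 64)) * (64 ^ n * n.factorial) := by ring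
    _ = _ := by rw [h2, one_mul]

/-- Pointwise Lipschitz bound for the Gaussian. `p`, `q` are the two distances. -/
lemma heat_exp_lip {t p q d : ℝ} (ht : 0 < t) (hp : 0 ≤ p) (hq : 0 ≤ q) (hd : |q - p| ≤ d)
    (hdt : d ≤ Real.sqrt t) :
    |Real.exp (-q ^ 2 / (4 * t)) - Real.exp (-p ^ 2 / (4 * t))| ≤
      d * (10 * t ^ (-(1:ℝ) / 2)) * Real.exp (-p ^ 2 / (16 * t)) := by
  obtain ⟨s, hs, rfl⟩ : ∃ s, 0 < s ∧ t = s ^ 2 := ⟨Real.sqrt t, by positivity, (Real.sq_sqrt ht.le).symm⟩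
  rw [Real.sqrt_sq hs.le] at hdt
  have hts : (s ^ 2) ^ (-(1:ℝ) / 2) = s⁻¹ := by
    rw [← Real.rpow_natCast, ← Real.rpow_mul hs.le, ← Real.rpow_neg_one]; norm_num
  rw [hts]
  have hd0 : 0 ≤ d := (abs_nonneg _).trans hd
  have key : ∀ A B : ℝ, |Real.exp (-A) - Real.exp (-B)| ≤
      |A - B| * max (Real.exp (-A)) (Real.exp (-B)) := by
    have aux : ∀ A B : ℝ, A ≤ B → |Real.exp (-A) - Real.exp (-B)| ≤
      |A - B| * Real.exp (-A) := by
      intro A B h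
      rw [abs_of_nonneg (by rw [sub_nonneg]; apply Real.exp_le_exp.2; linarith),
        abs_of_nonpos (by linarith)]
      have h1 := Real.add_one_le_exp (A - B)
      have h2 : Real.exp (-B) = Real.exp (A - B) * Real.exp (-A) := by
        rw [← Real.exp_add]; congr 1; ring
      rw [h2]
      have := Real.exp_pos (-A)
      nlinarith
    intro A B
    rcases le_total A B with h | h
    · exact (aux A B h).trans (by gcongr; exact le_max_left _ _)
    · rw [abs_sub_comm, abs_sub_comm A]
      exact (aux B A h).trans (by gcongr; exact le_max_right _ _)
  have hk := key (q ^ 2 / (4 * s ^ 2)) (p ^ 2 / (4 * s ^ 2))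
  rw [← neg_div, ← neg_div] at hk
  refine hk.trans ?_
  have hqp : q ≤ p + s := by linarith [(abs_le.1 (hd.trans hdt)).2]
  have hpq : p ≤ q + s := by linarith [(abs_le.1 (hd.trans hdt)).1]
  have h1 : |q ^ 2 / (4 * s ^ 2) - p ^ 2 / (4 * s ^ 2)| ≤ d * ((2 * p + s) / (4 * s ^ 2)) := by
    rw [← sub_div, abs_div, abs_of_pos (by positivity : 0 < 4 * s ^ 2), ← mul_div_assoc]
    gcongr
    rw [show q ^ 2 - p ^ 2 = (q - p) * (q + p) by ring, abs_mul, abs_of_nonneg (by linarith : 0 ≤ q + p)]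
    exact mul_le_mul hd (by linarith) (by linarith) hd0
  have h2 : max (Real.exp (-q ^ 2 / (4 * s ^ 2))) (Real.exp (-p ^ 2 / (4 * s ^ 2))) ≤
      Real.exp (1 / 4) * Real.exp (-p ^ 2 / (8 * s ^ 2)) := by
    rw [← Real.exp_add]
    apply max_le
    · apply Real.exp_le_exp.2
      rw [show (1:ℝ) / 4 + -p ^ 2 / (8 * s ^ 2) = (2 * s ^ 2 - p ^ 2) / 2 / (4 * s ^ 2) by field_simp; ring]
      gcongr
      nlinarith [sq_nonneg (q - s)]
    · apply Real.exp_le_exp.2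
      rw [show (1:ℝ) / 4 + -p ^ 2 / (8 * s ^ 2) = (2 * s ^ 2 - p ^ 2) / 2 / (4 * s ^ 2) by field_simp; ring]
      gcongr
      nlinarith [sq_nonneg p, sq_nonneg s]
  have h3 : (2 * p + s) / (4 * s ^ 2) * Real.exp (-p ^ 2 / (8 * s ^ 2)) ≤
      (17 / 4) * s⁻¹ * Real.exp (-p ^ 2 / (16 * s ^ 2)) := by
    have e1 : Real.exp (-p ^ 2 / (16 * s ^ 2)) =
        Real.exp (p ^ 2 / (16 * s ^ 2)) * Real.exp (-p ^ 2 / (8 * s ^ 2)) := by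
      rw [← Real.exp_add]; congr 1; field_simp; ring
    rw [e1, ← mul_assoc]
    gcongr
    have e2 := Real.add_one_le_exp (p ^ 2 / (16 * s ^ 2))
    calc (2 * p + s) / (4 * s ^ 2) ≤ 17 / 4 * s⁻¹ * (p ^ 2 / (16 * s ^ 2) + 1) := by
          rw [← sub_nonneg]
          have : 17 / 4 * s⁻¹ * (p ^ 2 / (16 * s ^ 2) + 1) - (2 * p + s) / (4 * s ^ 2)
            = ((p - 16 * s) ^ 2 + 16 * p ^ 2) / (64 * s ^ 3) := by field_simp; ring
          rw [this]; positivity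
      _ ≤ _ := by gcongr
  have h4 : Real.exp (1 / 4) ≤ 2 := by
    have : Real.exp (1/4) ≤ Real.exp (1/2) := Real.exp_le_exp.2 (by norm_num)
    have h5 : Real.exp (1/2) ^ 2 = Real.exp 1 := by rw [← Real.exp_nat_mul]; norm_num
    have := Real.exp_one_lt_d9
    nlinarith [Real.exp_pos (1/2)]
  calc _ ≤ d * ((2 * p + s) / (4 * s ^ 2)) * (Real.exp (1 / 4) * Real.exp (-p ^ 2 / (8 * s ^ 2))) := by
        gcongr
    _ = d * Real.exp (1 / 4) * ((2 * p + s) / (4 * s ^ 2) * Real.exp (-p ^ 2 / (8 * s ^ 2))) := by ring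
    _ ≤ d * 2 * ((17 / 4) * s⁻¹ * Real.exp (-p ^ 2 / (16 * s ^ 2))) := by gcongr
    _ = d * (17 / 2 * s⁻¹) * Real.exp (-p ^ 2 / (16 * s ^ 2)) := by ring
    _ ≤ _ := by gcongr; norm_num

lemma heat_convolution_bound {n : ℕ} (hn : 1 ≤ n) {a b : ℝ} (ha : 0 ≤ a) (ha1 : a < 1)
    (hb : 0 ≤ b) (hbn : b < n) :
    ∃ C : ℝ, 0 < C ∧ ∀ (t : ℝ), 0 < t → ∀ (x : EuclideanSpace ℝ (Fin n)) (R : ℝ),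
      R = max ‖x‖ (Real.sqrt t) →
      ∫ y : EuclideanSpace ℝ (Fin n), Real.exp (-‖x - y‖ ^ 2 / (16 * t)) * heatWgt a b ‖y‖
        ≤ C * t ^ ((n:ℝ) / 2) * heatWgt a b R := by
  have : Nonempty (Fin n) := ⟨⟨0, hn⟩⟩
  obtain ⟨β, hβ1, hβ2⟩ := exists_between hbn
  obtain ⟨M, hM, hgrow⟩ := heatWgt_growth ha ha1 hb hβ1
  have hgi := heat_ball_integrable hn hβ2
  set g : EuclideanSpace ℝ (Fin n) → ℝ :=
    fun y => (Set.Iio (1:ℝ)).indicator (fun s => s ^ (-β)) ‖y‖ with hg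
  have hg0 : ∀ y, 0 ≤ g y := fun y => by
    apply Set.indicator_apply_nonneg
    intro _
    positivity
  set G := ∫ y, g y with hG
  have hG0 : 0 ≤ G := integral_nonneg hg0
  refine ⟨M * 2 ^ β * (Real.pi * 16) ^ ((n:ℝ) / 2) + M * Real.exp 1 * (64 ^ n * n.factorial) * G,
    by positivity, fun t ht x R hR => ?_⟩
  have hst : 0 < Real.sqrt t := by positivity
  have hRt : Real.sqrt t ≤ R := hR ▸ le_max_right _ _
  have hR0 : 0 < R := hst.trans_le hRt
  have hwR := heatWgt_pos a b hR0.le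
  obtain ⟨hI, hIv⟩ := heat_gauss_integral (n := n) (c := 16 * t) (by positivity) x
  have hgR : Integrable (fun y => g (R⁻¹ • y)) :=
    (integrable_comp_smul_iff volume g (inv_ne_zero hR0.ne')).2 hgi
  have hgRv : ∫ y, g (R⁻¹ • y) = R ^ n * G := by
    rw [Measure.integral_comp_inv_smul_of_nonneg volume g hR0.le]
    simp [hG]
  have hpt : ∀ y : EuclideanSpace ℝ (Fin n), y ≠ 0 →
      Real.exp (-‖x - y‖ ^ 2 / (16 * t)) * heatWgt a b ‖y‖ ≤
      heatWgt a b R * (M * 2 ^ β * Real.exp (-‖x - y‖ ^ 2 / (16 * t)) +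
        M * Real.exp 1 * Real.exp (-R ^ 2 / (64 * t)) * g (R⁻¹ • y)) := by
    intro y hy
    have hy0 : 0 < ‖y‖ := norm_pos_iff.2 hy
    rcases lt_or_ge ‖y‖ (R / 2) with h | h
    · have h1 := hgrow ‖y‖ R hy0 (by linarith)
      have hgy : g (R⁻¹ • y) = (R / ‖y‖) ^ β := by
        have e : ‖R⁻¹ • y‖ = (R / ‖y‖)⁻¹ := by
          rw [norm_smul, norm_inv, Real.norm_of_nonneg hR0.le]; field_simp
        have e2 : ‖R⁻¹ • y‖ < 1 := by
          rw [e, inv_div, div_lt_one hR0]; linarith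
        simp only [hg]
        rw [Set.indicator_of_mem (show ‖R⁻¹ • y‖ ∈ Set.Iio 1 from e2), e,
          Real.inv_rpow (by positivity), Real.rpow_neg (by positivity), inv_inv]
      have h2 : Real.exp (-‖x - y‖ ^ 2 / (16 * t)) ≤
          Real.exp 1 * Real.exp (-R ^ 2 / (64 * t)) := by
        rw [← Real.exp_add]
        apply Real.exp_le_exp.2
        rw [show 1 + -R ^ 2 / (64 * t) = (16 * t - R ^ 2 / 4) / (16 * t) by field_simp; ring]
        gcongr
        rcases le_total ‖x‖ (Real.sqrt t) with hx | hx
        · rw [max_eq_right hx] at hR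
          rw [hR, Real.sq_sqrt ht.le]
          nlinarith [sq_nonneg ‖x - y‖]
        · rw [max_eq_left hx] at hR
          have : ‖x‖ - ‖y‖ ≤ ‖x - y‖ := norm_sub_norm_le x y
          have : R / 2 ≤ ‖x - y‖ := by linarith
          nlinarith
      rw [hgy]
      have : 0 ≤ heatWgt a b R * (M * 2 ^ β * Real.exp (-‖x - y‖ ^ 2 / (16 * t))) := by positivity
      calc _ ≤ (Real.exp 1 * Real.exp (-R ^ 2 / (64 * t))) *
            (M * heatWgt a b R * (R / ‖y‖) ^ β) := by
            apply mul_le_mul h2 h1 (heatWgt_pos a b hy0.le).le (by positivity)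
        _ ≤ _ := by linarith
    · have h1 := hgrow (R / 2) R (by positivity) (by linarith)
      rw [show R / (R / 2) = 2 by field_simp] at h1
      have h2 := heatWgt_anti ha hb (by positivity) h
      have := hg0 (R⁻¹ • y)
      have : 0 ≤ heatWgt a b R *
        (M * Real.exp 1 * Real.exp (-R ^ 2 / (64 * t)) * g (R⁻¹ • y)) := by positivity
      calc _ ≤ Real.exp (-‖x - y‖ ^ 2 / (16 * t)) * (M * heatWgt a b R * 2 ^ β) := by
            gcongr
            exact h2.trans h1
        _ ≤ _ := by linarith
  have hint := ((hI.const_mul (M * 2 ^ β)).add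
    (hgR.const_mul (M * Real.exp 1 * Real.exp (-R ^ 2 / (64 * t))))).const_mul (heatWgt a b R)
  have hle := integral_mono_of_nonneg (μ := volume)
    (Filter.Eventually.of_forall fun y : EuclideanSpace ℝ (Fin n) =>
      mul_nonneg (Real.exp_pos (-‖x - y‖ ^ 2 / (16 * t))).le
        (heatWgt_pos a b (norm_nonneg y)).le) hint
    (by
      have : ∀ᵐ y : EuclideanSpace ℝ (Fin n), y ≠ 0 := by simp [ae_iff]
      filter_upwards [this] with y hy
      exact hpt y hy)
  refine hle.trans ?_
  simp only [Pi.add_apply]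
  rw [integral_const_mul, integral_add (hI.const_mul _) (hgR.const_mul _), integral_const_mul,
    integral_const_mul, hIv, hgRv]
  have hpow : R ^ n * Real.exp (-R ^ 2 / (64 * t)) ≤ t ^ ((n:ℝ)/2) * (64 ^ n * n.factorial) := by
    have h := heat_pow_exp n (s := R / Real.sqrt t) (by rw [le_div_iff₀ hst]; linarith)
    have e1 : t ^ ((n:ℝ)/2) = Real.sqrt t ^ n := by
      rw [Real.sqrt_eq_rpow, ← Real.rpow_natCast, ← Real.rpow_mul ht.le]; congr 1; ring
    have e2 : -(R / Real.sqrt t) ^ 2 / 64 = -R ^ 2 / (64 * t) := by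
      rw [div_pow, Real.sq_sqrt ht.le]; field_simp
    rw [e2, div_pow] at h
    rw [e1]
    calc R ^ n * Real.exp (-R ^ 2 / (64 * t))
        = Real.sqrt t ^ n * (R ^ n / Real.sqrt t ^ n * Real.exp (-R ^ 2 / (64 * t))) := by
          field_simp
      _ ≤ _ := by gcongr
  rw [← mul_assoc Real.pi, Real.mul_rpow (by positivity) ht.le]
  calc _ = heatWgt a b R * (M * 2 ^ β * ((Real.pi * 16) ^ ((n:ℝ) / 2) * t ^ ((n:ℝ) / 2)) +
        M * Real.exp 1 * (R ^ n * Real.exp (-R ^ 2 / (64 * t))) * G) := by ring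
    _ ≤ heatWgt a b R * (M * 2 ^ β * ((Real.pi * 16) ^ ((n:ℝ) / 2) * t ^ ((n:ℝ) / 2)) +
        M * Real.exp 1 * (t ^ ((n:ℝ)/2) * (64 ^ n * n.factorial)) * G) := by gcongr
    _ = _ := by ring

lemma heat_fderiv_bound {n : ℕ} (hn : 1 ≤ n) {a b : ℝ} (ha : 0 ≤ a) (ha1 : a < 1)
    (hb : 0 ≤ b) (hbn : b < n) :
    ∃ C : ℝ, 0 < C ∧ ∀ Θ₀ : EuclideanSpace ℝ (Fin n) → ℝ, Measurable Θ₀ →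
        (∀ y, |Θ₀ y| ≤ heatWgt a b ‖y‖) →
      ∀ (t : ℝ), 0 < t → ∀ (x : EuclideanSpace ℝ (Fin n)) (R : ℝ),
      R = max ‖x‖ (Real.sqrt t) →
      ‖fderiv ℝ (fun x' : EuclideanSpace ℝ (Fin n) =>
              (4 * Real.pi * t) ^ (-(n : ℝ) / 2)
                * ∫ y, Real.exp (-‖x' - y‖ ^ 2 / (4 * t)) * Θ₀ y) x‖
        ≤ C * heatWgt a b R * t ^ (-(1:ℝ) / 2) := by
  obtain ⟨C, hC, hconv⟩ := heat_convolution_bound hn ha ha1 hb hbn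
  refine ⟨(4 * Real.pi) ^ (-(n:ℝ) / 2) * 10 * C, by positivity, fun Θ₀ hm hΘ t ht x R hR => ?_⟩
  have hst : 0 < Real.sqrt t := by positivity
  have hR0 : 0 < R := hst.trans_le (hR ▸ le_max_right _ _)
  have hwR := heatWgt_pos a b hR0.le
  have hbd : ∀ y : EuclideanSpace ℝ (Fin n), |heatWgt a b ‖y‖| ≤ heatWgt a b 0 := fun y => by
    rw [abs_of_pos (heatWgt_pos a b (norm_nonneg y))]
    exact heatWgt_anti ha hb le_rfl (norm_nonneg y)
  have hwm : Measurable (fun y : EuclideanSpace ℝ (Fin n) => heatWgt a b ‖y‖) := by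
    unfold heatWgt
    fun_prop
  have hint : ∀ z : EuclideanSpace ℝ (Fin n),
      Integrable (fun y => Real.exp (-‖z - y‖ ^ 2 / (4 * t)) * Θ₀ y) := fun z =>
    (heat_gauss_integral (c := 4 * t) (by positivity) z).1.mul_bdd
      hm.aestronglyMeasurable (Filter.Eventually.of_forall fun y =>
        ((hΘ y).trans (le_abs_self _)).trans (hbd y))
  have hintw : Integrable (fun y => Real.exp (-‖x - y‖ ^ 2 / (16 * t)) * heatWgt a b ‖y‖) :=
    (heat_gauss_integral (c := 16 * t) (by positivity) x).1.mul_bdd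
      hwm.aestronglyMeasurable (Filter.Eventually.of_forall hbd)
  apply norm_fderiv_le_of_lip' ℝ (by positivity)
  filter_upwards [Metric.closedBall_mem_nhds x hst] with x' hx'
  rw [mem_closedBall_iff_norm] at hx'
  rw [← mul_sub, ← integral_sub (hint x') (hint x), norm_mul,
    Real.norm_of_nonneg (by positivity : 0 ≤ (4 * Real.pi * t) ^ (-(n:ℝ) / 2))]
  have h1 : ‖∫ y, (Real.exp (-‖x' - y‖ ^ 2 / (4 * t)) * Θ₀ y -
      Real.exp (-‖x - y‖ ^ 2 / (4 * t)) * Θ₀ y)‖ ≤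
      ∫ y, ‖x' - x‖ * (10 * t ^ (-(1:ℝ) / 2)) *
        (Real.exp (-‖x - y‖ ^ 2 / (16 * t)) * heatWgt a b ‖y‖) := by
    apply norm_integral_le_of_norm_le (hintw.const_mul _)
    refine Filter.Eventually.of_forall fun y => ?_
    rw [← sub_mul, norm_mul, Real.norm_eq_abs, Real.norm_eq_abs, ← mul_assoc]
    apply mul_le_mul _ (hΘ y) (abs_nonneg _) (by positivity)
    apply heat_exp_lip ht (norm_nonneg _) (norm_nonneg _) _ hx'
    have := abs_norm_sub_norm_le (x' - y) (x - y)
    simpa using this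
  rw [integral_const_mul] at h1
  calc _ ≤ (4 * Real.pi * t) ^ (-(n:ℝ) / 2) * (‖x' - x‖ * (10 * t ^ (-(1:ℝ) / 2)) *
        (C * t ^ ((n:ℝ) / 2) * heatWgt a b R)) := by
        gcongr
        refine h1.trans ?_
        gcongr
        exact hconv t ht x R hR
    _ = (4 * Real.pi) ^ (-(n:ℝ) / 2) * 10 * C * heatWgt a b R * t ^ (-(1:ℝ) / 2) * ‖x' - x‖ *
        (t ^ (-(n:ℝ) / 2) * t ^ ((n:ℝ) / 2)) := by
        rw [Real.mul_rpow (by positivity) ht.le]; ring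
    _ = _ := by
        rw [← Real.rpow_add ht, show -(n:ℝ) / 2 + (n:ℝ) / 2 = 0 by ring, Real.rpow_zero, mul_one]

/-- Gradient decay estimate (Lemma 2.3): if `|Θ₀(y)| ≤ ⟨y⟩^{−b}(log(2+|y|))^{−a}`, then the
spatial gradient of `Θ(x,t) = (4πt)^{−n/2} ∫ e^{−|x−y|²/(4t)} Θ₀(y) dy` satisfies, for `t` large,
`|∇Θ| ≤ C⟨t⟩^{−b/2}(log(2+t))^{−a} t^{−1/2}` for `|x| ≤ √t` and
`|∇Θ| ≤ C⟨x⟩^{−b}(log(2+|x|))^{−a}|x|/t` for `|x| > √t`. -/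
theorem heat_semigroup_gradient_decay (n : ℕ) (hn : 1 ≤ n) (a b : ℝ)
    (ha : a ∈ Set.Ico (0:ℝ) 1) (hb0 : 0 ≤ b) (hbn : b < n) :
    ∃ C t0 : ℝ, 0 < C ∧ 0 < t0 ∧
      ∀ Θ₀ : EuclideanSpace ℝ (Fin n) → ℝ, Measurable Θ₀ →
        (∀ y, |Θ₀ y| ≤ Real.sqrt (1 + ‖y‖ ^ 2) ^ (-b) * Real.log (2 + ‖y‖) ^ (-a)) →
      ∀ t : ℝ, t0 ≤ t → ∀ x : EuclideanSpace ℝ (Fin n),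
        (‖x‖ ≤ Real.sqrt t →
          ‖fderiv ℝ (fun x' : EuclideanSpace ℝ (Fin n) =>
              (4 * Real.pi * t) ^ (-(n : ℝ) / 2)
                * ∫ y, Real.exp (-‖x' - y‖ ^ 2 / (4 * t)) * Θ₀ y) x‖
            ≤ C * Real.sqrt (1 + t ^ 2) ^ (-(b / 2)) * Real.log (2 + t) ^ (-a)
              * t ^ (-(1 : ℝ) / 2)) ∧
        (Real.sqrt t < ‖x‖ →
          ‖fderiv ℝ (fun x' : EuclideanSpace ℝ (Fin n) =>
              (4 * Real.pi * t) ^ (-(n : ℝ) / 2)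
                * ∫ y, Real.exp (-‖x' - y‖ ^ 2 / (4 * t)) * Θ₀ y) x‖
            ≤ C * Real.sqrt (1 + ‖x‖ ^ 2) ^ (-b) * Real.log (2 + ‖x‖) ^ (-a)
              * (‖x‖ / t)) := by
  obtain ⟨C, hC, h⟩ := heat_fderiv_bound hn ha.1 ha.2 hb0 hbn
  refine ⟨C * 2 ^ a, 1, by positivity, one_pos, fun Θ₀ hm hΘ t ht x => ?_⟩
  have ht0 : 0 < t := by linarith
  have hst : 0 < Real.sqrt t := by positivity
  have hF := h Θ₀ hm hΘ t ht0 x _ rfl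
  have h2a : (1:ℝ) ≤ 2 ^ a := Real.one_le_rpow (by norm_num) ha.1
  constructor
  · intro hx
    rw [max_eq_right hx] at hF
    refine hF.trans ?_
    have hw : heatWgt a b (Real.sqrt t) ≤
        2 ^ a * (Real.sqrt (1 + t ^ 2) ^ (-(b / 2)) * Real.log (2 + t) ^ (-a)) := by
      unfold heatWgt
      rw [Real.sq_sqrt ht0.le]
      have L1 := heatWgt_log_pos hst.le
      have L2 := heatWgt_log_pos ht0.le
      have e1 : Real.sqrt (1 + t) ^ (-b) ≤ Real.sqrt (1 + t ^ 2) ^ (-(b / 2)) := by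
        rw [Real.sqrt_eq_rpow (1 + t), ← Real.rpow_mul (by positivity),
          show 1 / 2 * -b = -(b / 2) by ring]
        apply Real.rpow_le_rpow_of_nonpos (by positivity) _ (by linarith)
        apply Real.sqrt_le_iff.2
        constructor <;> nlinarith
      have e2 : Real.log (2 + Real.sqrt t) ^ (-a) ≤ 2 ^ a * Real.log (2 + t) ^ (-a) := by
        have e3 : Real.log (2 + t) ≤ 2 * Real.log (2 + Real.sqrt t) := by
          have : 2 * Real.log (2 + Real.sqrt t) = Real.log ((2 + Real.sqrt t) ^ 2) := by
            rw [Real.log_pow]; norm_num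
          rw [this]
          apply Real.log_le_log (by linarith)
          nlinarith [Real.sq_sqrt ht0.le]
        have e4 := Real.rpow_le_rpow_of_nonpos L2 e3 (by linarith [ha.1] : -a ≤ 0)
        rw [Real.mul_rpow (by norm_num) L1.le] at e4
        calc Real.log (2 + Real.sqrt t) ^ (-a)
            = 2 ^ a * (2 ^ (-a) * Real.log (2 + Real.sqrt t) ^ (-a)) := by
              rw [Real.rpow_neg (by norm_num : (0:ℝ) ≤ 2)]; field_simp
          _ ≤ _ := by gcongr
      calc _ ≤ Real.sqrt (1 + t ^ 2) ^ (-(b / 2)) * (2 ^ a * Real.log (2 + t) ^ (-a)) := by gcongr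
        _ = _ := by ring
    calc _ ≤ C * (2 ^ a * (Real.sqrt (1 + t ^ 2) ^ (-(b / 2)) * Real.log (2 + t) ^ (-a))) *
          t ^ (-(1:ℝ) / 2) := by gcongr
      _ = _ := by ring
  · intro hx
    rw [max_eq_left hx.le] at hF
    refine hF.trans ?_
    have hw := heatWgt_pos a b (norm_nonneg x)
    have e1 : t ^ (-(1:ℝ) / 2) ≤ ‖x‖ / t := by
      have : t ^ (-(1:ℝ) / 2) = Real.sqrt t / t := by
        rw [Real.sqrt_eq_rpow, ← Real.rpow_sub_one ht0.ne']; norm_num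
      rw [this]
      gcongr
    calc C * heatWgt a b ‖x‖ * t ^ (-(1:ℝ) / 2)
        ≤ C * heatWgt a b ‖x‖ * (‖x‖ / t) * 1 := by rw [mul_one]; gcongr
      _ ≤ C * heatWgt a b ‖x‖ * (‖x‖ / t) * 2 ^ a := by gcongr
      _ = _ := by unfold heatWgt; ring
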